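/- Let Λ be a finite subset of ℤ², with sites i, j ∈ Λ neighbors when |i − j| = 1, let α ≥ 0 and Y : Λ → {0,1}. A binary image X̂ maximizes L_α(·|Y) over all binary images on Λ if and only if the cut 𝒞(X̂) has minimum capacity among all cuts determined by binary images, i.e. C_{Y,α}(X̂) ≤ C_{Y,α}(Z) for every binary image Z on Λ. -/

import Mathlib

/-- Two sites of `ℤ²` are neighbors when `|i - j| = 1`. -/
abbrev Nbr (i j : ℤ × ℤ) : Prop :=
  (i.1 - j.1).natAbs + (i.2 - j.2).natAbs = 1

/-- A fixed linear (lexicographic) order on `ℤ²`, used to count each unordered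
pair exactly once. -/
abbrev OrdLt (i j : ℤ × ℤ) : Prop :=
  i.1 < j.1 ∨ (i.1 = j.1 ∧ i.2 < j.2)

/-- The number of unordered neighbor pairs `{i, j} ⊆ Λ` satisfying `Q i j`. -/
def nbrPairCount (Λ : Finset (ℤ × ℤ)) (Q : (ℤ × ℤ) → (ℤ × ℤ) → Prop)
    [DecidableRel Q] : ℕ :=
  ((Λ ×ˢ Λ).filter (fun p => OrdLt p.1 p.2 ∧ Nbr p.1 p.2 ∧ Q p.1 p.2)).card

/-- The vertex set of the network: the sites of `ℤ²` (`Sum.inl i`) together with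
a source `Sum.inr false` and a sink `Sum.inr true`. -/
abbrev V : Type := (ℤ × ℤ) ⊕ Bool

/-- The source `s`. -/
def src : V := Sum.inr false

/-- The sink `t`. -/
def snk : V := Sum.inr true

/-- Arc capacities of the network `N_α(Y)`: `c(s,i) = α` if `Y i = 1` (else `0`),
`c(i,t) = α` if `Y i = 0` (else `0`), `c(i,j) = 1` for each ordered pair of
neighbor sites of `Λ`, and all other arcs have capacity `0`. -/
noncomputable def cap (Λ : Finset (ℤ × ℤ)) (Y : (ℤ × ℤ) → Bool) (α : ℝ) :
    V → V → ℝ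
  | Sum.inr false, Sum.inl i => if i ∈ Λ ∧ Y i = true then α else 0
  | Sum.inl i, Sum.inr true => if i ∈ Λ ∧ Y i = false then α else 0
  | Sum.inl i, Sum.inl j => if i ∈ Λ ∧ j ∈ Λ ∧ Nbr i j then (1 : ℝ) else 0
  | _, _ => 0

/-- The arcs of the network: `(s,i)` and `(i,t)` for sites `i ∈ Λ`, and `(i,j)`
for ordered pairs of neighbor sites of `Λ`. -/
def isArc (Λ : Finset (ℤ × ℤ)) : V → V → Bool
  | Sum.inr false, Sum.inl i => decide (i ∈ Λ)
  | Sum.inl i, Sum.inr true => decide (i ∈ Λ)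
  | Sum.inl i, Sum.inl j => decide (i ∈ Λ ∧ j ∈ Λ ∧ Nbr i j)
  | _, _ => false

/-- Embedding of the sites into the vertex set. -/
def siteEmb : (ℤ × ℤ) ↪ V := ⟨Sum.inl, Sum.inl_injective⟩

/-- `A(X) = {s} ∪ {i ∈ Λ : X i = 1}`. -/
def Aset (Λ : Finset (ℤ × ℤ)) (X : (ℤ × ℤ) → Bool) : Finset V :=
  insert (Sum.inr false) ((Λ.filter (fun i => X i = true)).map siteEmb)

/-- `B(X) = {t} ∪ {i ∈ Λ : X i = 0}`. -/
def Bset (Λ : Finset (ℤ × ℤ)) (X : (ℤ × ℤ) → Bool) : Finset V :=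
  insert (Sum.inr true) ((Λ.filter (fun i => X i = false)).map siteEmb)

/-- The cut `𝒞(X)` determined by the binary image `X`: all arcs `(u,v)` of the
network with `u ∈ A(X)` and `v ∈ B(X)`. -/
def cutF (Λ : Finset (ℤ × ℤ)) (X : (ℤ × ℤ) → Bool) : Finset (V × V) :=
  (Aset Λ X ×ˢ Bset Λ X).filter (fun p => isArc Λ p.1 p.2 = true)

/-- The capacity `C_{Y,α}(X)` of the cut `𝒞(X)` in the network `N_α(Y)`. -/
noncomputable def cutCap (Λ : Finset (ℤ × ℤ)) (Y : (ℤ × ℤ) → Bool) (α : ℝ)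
    (X : (ℤ × ℤ) → Bool) : ℝ :=
  ∑ p ∈ cutF Λ X, cap Λ Y α p.1 p.2

/-- `D_{Y,α}(E) = Σ_{e ∈ E} c_{Y,α}(e)` for a set of arcs `E`. -/
noncomputable def Dsum (Λ : Finset (ℤ × ℤ)) (Y : (ℤ × ℤ) → Bool) (α : ℝ)
    (E : Finset (V × V)) : ℝ :=
  ∑ p ∈ E, cap Λ Y α p.1 p.2

/-- `L_α(X | Y)`: the posterior objective for binary images. -/
noncomputable def Lfun (Λ : Finset (ℤ × ℤ)) (α : ℝ) (X Y : (ℤ × ℤ) → Bool) : ℝ :=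
  α * (Λ.filter (fun i => X i = Y i)).card
    + nbrPairCount Λ (fun i j => X i = X j)

lemma nbrPairCount_add_not (Λ : Finset (ℤ × ℤ)) (Q : (ℤ × ℤ) → (ℤ × ℤ) → Prop)
    [DecidableRel Q] :
    nbrPairCount Λ Q + nbrPairCount Λ (fun i j => ¬ Q i j) =
      nbrPairCount Λ (fun _ _ => True) := by
  simp only [nbrPairCount, and_true, ← and_assoc]
  rw [← Finset.filter_filter,
    ← Finset.filter_filter (fun p : (ℤ × ℤ) × (ℤ × ℤ) => OrdLt p.1 p.2 ∧ Nbr p.1 p.2)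
      (fun p => ¬ Q p.1 p.2)]
  exact Finset.card_filter_add_card_filter_not _

/-- Each unordered pair of neighbors with different colours contributes exactly one ordered pair
from a site of colour `1` to a site of colour `0`. -/
lemma card_directed_boundary (Λ : Finset (ℤ × ℤ)) (X : (ℤ × ℤ) → Bool) :
    ((Λ ×ˢ Λ).filter (fun p => Nbr p.1 p.2 ∧ X p.1 = true ∧ X p.2 = false)).card =
      nbrPairCount Λ (fun i j => ¬ X i = X j) := by
  unfold nbrPairCount
  refine Finset.card_nbij' (fun p => if OrdLt p.1 p.2 then p else p.swap)
    (fun p => if X p.1 = true then p else p.swap) ?_ ?_ ?_ ?_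
  · rintro ⟨⟨a, b⟩, c, d⟩ h
    simp only [Finset.coe_filter, Set.mem_ofPred_eq, Finset.mem_product] at h ⊢
    obtain ⟨⟨hi, hj⟩, hn, hX, hX'⟩ := h
    split_ifs with ho
    · exact ⟨⟨hi, hj⟩, ho, hn, by simp [hX, hX']⟩
    · refine ⟨⟨hj, hi⟩, ?_, ?_, by simp [hX, hX']⟩ <;>
        simp only [OrdLt, Nbr, Prod.swap] at * <;> omega
  · rintro ⟨⟨a, b⟩, c, d⟩ h
    simp only [Finset.coe_filter, Set.mem_ofPred_eq, Finset.mem_product] at h ⊢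
    obtain ⟨⟨hi, hj⟩, ho, hn, hX⟩ := h
    split_ifs with h1
    · exact ⟨⟨hi, hj⟩, hn, h1, by simpa [h1] using hX⟩
    · refine ⟨⟨hj, hi⟩, ?_, ?_, by simpa using h1⟩
      · simp only [Nbr, Prod.swap] at *; omega
      · simpa [Bool.not_eq_true _ ▸ h1] using hX
  · rintro ⟨i, j⟩ h
    simp only [Finset.coe_filter, Set.mem_ofPred_eq] at h
    by_cases ho : OrdLt i j <;> simp [ho, h.2.2.1, h.2.2.2]
  · rintro ⟨⟨a, b⟩, c, d⟩ h
    simp only [Finset.coe_filter, Set.mem_ofPred_eq] at h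
    obtain ⟨-, ho, -, -⟩ := h
    have ho' : ¬ OrdLt (c, d) (a, b) := by simp only [OrdLt] at *; omega
    by_cases h1 : X (a, b) = true
    · simp only [h1, if_true, if_pos ho]
    · simp only [h1, Prod.swap, if_neg ho', Bool.false_eq_true, if_false]

lemma cap_eq_zero_of_not_isArc (Λ : Finset (ℤ × ℤ)) (Y : (ℤ × ℤ) → Bool) (α : ℝ) (u v : V)
    (h : ¬ isArc Λ u v = true) : cap Λ Y α u v = 0 := by
  rcases u with i | _ | _ <;> rcases v with j | _ | _ <;> simp_all [isArc, cap]

lemma cutCap_eq (Λ : Finset (ℤ × ℤ)) (Y : (ℤ × ℤ) → Bool) (α : ℝ) (X : (ℤ × ℤ) → Bool) :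
    cutCap Λ Y α X =
      α * (Λ.filter (fun i => ¬ X i = Y i)).card + nbrPairCount Λ (fun i j => ¬ X i = X j) := by
  have hcut : cutCap Λ Y α X = ∑ u ∈ Aset Λ X, ∑ v ∈ Bset Λ X, cap Λ Y α u v := by
    rw [cutCap, cutF, Finset.sum_filter, ← Finset.sum_product']
    refine Finset.sum_congr rfl fun p _ => ?_
    split_ifs with h
    · rfl
    · exact (cap_eq_zero_of_not_isArc Λ Y α _ _ h).symm
  have hinner (u : V) : ∑ v ∈ Bset Λ X, cap Λ Y α u v =
      cap Λ Y α u (Sum.inr true) +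
        ∑ j ∈ Λ.filter (fun j => X j = false), cap Λ Y α u (Sum.inl j) := by
    rw [Bset, Finset.sum_insert (by simp [siteEmb]), Finset.sum_map]; rfl
  have hsite : α * ((Λ.filter (fun i => ¬ X i = Y i)).card : ℝ) =
      ∑ j ∈ Λ.filter (fun j => X j = false), cap Λ Y α (Sum.inr false) (Sum.inl j) +
        ∑ i ∈ Λ.filter (fun i => X i = true), cap Λ Y α (Sum.inl i) (Sum.inr true) := by
    rw [Finset.card_filter, Finset.sum_filter, Finset.sum_filter, ← Finset.sum_add_distrib,
      Nat.cast_sum, Finset.mul_sum]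
    refine Finset.sum_congr rfl fun i hi => ?_
    cases hX : X i <;> cases hY : Y i <;> simp [cap, hi, hY]
  have hpair : (nbrPairCount Λ (fun i j => ¬ X i = X j) : ℝ) =
      ∑ i ∈ Λ.filter (fun i => X i = true), ∑ j ∈ Λ.filter (fun j => X j = false),
        cap Λ Y α (Sum.inl i) (Sum.inl j) := by
    rw [← card_directed_boundary, Finset.card_filter, Nat.cast_sum, Finset.sum_product,
      Finset.sum_filter]
    refine Finset.sum_congr rfl fun i hi => ?_
    rw [Finset.sum_filter]
    cases hX : X i
    · simp [hX]
    · rw [if_pos rfl]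
      refine Finset.sum_congr rfl fun j hj => ?_
      cases hX' : X j <;> simp [cap, hi, hj, hX]
  rw [hcut, Aset, Finset.sum_insert (by simp [siteEmb]), Finset.sum_map, hsite, hpair]
  simp only [hinner, Finset.sum_add_distrib, siteEmb, Function.Embedding.coeFn_mk]
  simp only [cap, zero_add]
  ring

lemma Lfun_add_cutCap (Λ : Finset (ℤ × ℤ)) (Y : (ℤ × ℤ) → Bool) (α : ℝ)
    (X : (ℤ × ℤ) → Bool) :
    Lfun Λ α X Y + cutCap Λ Y α X = α * Λ.card + nbrPairCount Λ (fun _ _ => True) := by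
  rw [cutCap_eq, Lfun, ← nbrPairCount_add_not Λ (fun i j => X i = X j),
    ← Finset.card_filter_add_card_filter_not (s := Λ) (fun i => X i = Y i)]
  push_cast
  ring

/-- A binary image `X̂` maximizes `L_α(· | Y)` over all binary images on `Λ`
iff its cut has minimum capacity among all cuts determined by binary images. -/
theorem map_iff_min_cut (Λ : Finset (ℤ × ℤ)) (α : ℝ) (hα : 0 ≤ α)
    (Y Xhat : (ℤ × ℤ) → Bool) :
    (∀ Z : (ℤ × ℤ) → Bool, Lfun Λ α Z Y ≤ Lfun Λ α Xhat Y) ↔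
      (∀ Z : (ℤ × ℤ) → Bool, cutCap Λ Y α Xhat ≤ cutCap Λ Y α Z) := by
  refine forall_congr' fun Z => ?_
  have hZ := Lfun_add_cutCap Λ Y α Z
  have hX := Lfun_add_cutCap Λ Y α Xhat
  constructor <;> intro h <;> linarith
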